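/- Let n ≥ 3 and let Γ ≤ SL(n,ℝ) be a lattice, i.e. a discrete subgroup admitting a Borel fundamental domain of finite Haar measure in SL(n,ℝ). For i = 1,2 let p_i be a point of ℙ contained in a projective hyperplane L_i. Then for all ε > 0 and δ > 0 there exists g ∈ Γ such that dist(g • p₁, p₂) < ε and the Hausdorff distance between the sets g • L₁ and L₂ in ℙ is less than δ. -/

import Mathlib

/- Common setup: `SL(n,ℤ)`, `SL(n,ℝ)`, the real projective space `ℙ^{n-1}(ℝ)`
with its quotient topology and the projective action, rank-1 unipotent elements
and their attracting points / fixed hyperplanes, metrics compatible with the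
topology of `ℙ`, `ε`-neighbourhoods, Schottky systems, profinite density,
maximal subgroups, and lattices in `SL(n,ℝ)`. -/

open Matrix LinearAlgebra.Projectivization

abbrev SLZ (n : ℕ) := Matrix.SpecialLinearGroup (Fin n) ℤ

abbrev SLR (n : ℕ) := Matrix.SpecialLinearGroup (Fin n) ℝ

/-- The real projective space `ℙ^{n-1}(ℝ)`: the projectivization of `ℝⁿ`. -/
abbrev Proj (n : ℕ) := Projectivization ℝ (Fin n → ℝ)

/-- The quotient topology on `ℙ^{n-1}(ℝ)`. -/
noncomputable instance (n : ℕ) : TopologicalSpace (Proj n) :=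
  inferInstanceAs (TopologicalSpace (Quotient _))

/-- The action of `SL(n,ℝ)` on `ℙ^{n-1}(ℝ)` induced by the linear action on `ℝⁿ`. -/
noncomputable def actR {n : ℕ} (g : SLR n) (x : Proj n) : Proj n :=
  Projectivization.map (Matrix.SpecialLinearGroup.toLin' g).toLinearMap
    (Matrix.SpecialLinearGroup.toLin' g).injective x

/-- The action of `SL(n,ℤ)` on `ℙ^{n-1}(ℝ)` induced by the linear action on `ℝⁿ`. -/
noncomputable def act {n : ℕ} (g : SLZ n) (x : Proj n) : Proj n :=
  actR (Matrix.SpecialLinearGroup.map (Int.castRingHom ℝ) g) x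

/-- The real matrix attached to `g ∈ SL(n,ℤ)`. -/
noncomputable def matR {n : ℕ} (g : SLZ n) : Matrix (Fin n) (Fin n) ℝ :=
  ((Matrix.SpecialLinearGroup.map (Int.castRingHom ℝ)) g : Matrix (Fin n) (Fin n) ℝ)

/-- The subspace `Im(u - I) ⊆ ℝⁿ` (a line when `u` is rank-1 unipotent). -/
noncomputable def lineOf {n : ℕ} (u : SLZ n) : Submodule ℝ (Fin n → ℝ) :=
  LinearMap.range (Matrix.mulVecLin (matR u - 1))

/-- The subspace `ker(u - I) ⊆ ℝⁿ` (a hyperplane when `u` is rank-1 unipotent). -/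
noncomputable def hypOf {n : ℕ} (u : SLZ n) : Submodule ℝ (Fin n → ℝ) :=
  LinearMap.ker (Matrix.mulVecLin (matR u - 1))

/-- The rational matrix attached to `g ∈ SL(n,ℤ)`. -/
noncomputable def matQ {n : ℕ} (g : SLZ n) : Matrix (Fin n) (Fin n) ℚ :=
  ((Matrix.SpecialLinearGroup.map (Int.castRingHom ℚ)) g : Matrix (Fin n) (Fin n) ℚ)

/-- `g - I`, as a `ℚ`-linear endomorphism of `ℚⁿ`. -/
noncomputable def linQ {n : ℕ} (g : SLZ n) : (Fin n → ℚ) →ₗ[ℚ] (Fin n → ℚ) :=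
  Matrix.mulVecLin (matQ g - 1)

/-- `u` is a rank-1 unipotent element of `SL(n,ℤ)`: `u - I` is nilpotent of rank one. -/
def IsR1U {n : ℕ} (u : SLZ n) : Prop :=
  IsNilpotent (linQ u) ∧ Module.finrank ℚ (LinearMap.range (linQ u)) = 1

/-- The point of attraction `p_u` of `u`, as a subset of `ℙ` (a singleton when `u` is a
rank-1 unipotent): the projective points whose representative spans `Im(u - I)`. -/
def attSet {n : ℕ} (u : SLZ n) : Set (Proj n) :=
  {x | x.submodule = lineOf u}

/-- The fixed hyperplane `L_u` of `u`, as a subset of `ℙ`. -/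
def fixSet {n : ℕ} (u : SLZ n) : Set (Proj n) :=
  {x | x.submodule ≤ hypOf u}

/-- The subset of `ℙ` corresponding to a linear subspace `W ⊆ ℝⁿ`. -/
def projSet {n : ℕ} (W : Submodule ℝ (Fin n → ℝ)) : Set (Proj n) :=
  {x | x.submodule ≤ W}

/-- The image `g • W` of a subspace of `ℝⁿ` under `g ∈ SL(n,ℤ)`. -/
noncomputable def actSub {n : ℕ} (g : SLZ n) (W : Submodule ℝ (Fin n → ℝ)) :
    Submodule ℝ (Fin n → ℝ) :=
  Submodule.map (Matrix.mulVecLin (matR g)) W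

/-- The image `g • W` of a subspace of `ℝⁿ` under `g ∈ SL(n,ℝ)`. -/
noncomputable def actSubR {n : ℕ} (g : SLR n) (W : Submodule ℝ (Fin n → ℝ)) :
    Submodule ℝ (Fin n → ℝ) :=
  Submodule.map (Matrix.mulVecLin (g : Matrix (Fin n) (Fin n) ℝ)) W

/-- `d` is a metric on `ℙ^{n-1}(ℝ)` inducing the quotient topology. -/
structure IsCompatMetric {n : ℕ} (d : Proj n → Proj n → ℝ) : Prop where
  self : ∀ x, d x x = 0
  eq_of : ∀ x y, d x y = 0 → x = y
  symm : ∀ x y, d x y = d y x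
  triangle : ∀ x y z, d x z ≤ d x y + d y z
  inducing : ∀ s : Set (Proj n), IsOpen s ↔ ∀ x ∈ s, ∃ ε > 0, ∀ y, d x y < ε → y ∈ s

/-- The distance from a point to a set. -/
noncomputable def setDist {n : ℕ} (d : Proj n → Proj n → ℝ) (x : Proj n)
    (A : Set (Proj n)) : ℝ :=
  sInf (d x '' A)

/-- The open `ε`-neighbourhood `(A)_ε = {x | dist(x, A) < ε}`. -/
def oThick {n : ℕ} (d : Proj n → Proj n → ℝ) (A : Set (Proj n)) (ε : ℝ) : Set (Proj n) :=
  {x | setDist d x A < ε}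

/-- The closed `ε`-neighbourhood `[A]_ε = {x | dist(x, A) ≤ ε}`. -/
def cThick {n : ℕ} (d : Proj n → Proj n → ℝ) (A : Set (Proj n)) (ε : ℝ) : Set (Proj n) :=
  {x | setDist d x A ≤ ε}

/-- The Hausdorff distance between two subsets of `ℙ`. -/
noncomputable def hDist {n : ℕ} (d : Proj n → Proj n → ℝ) (A B : Set (Proj n)) : ℝ :=
  max (sSup ((fun a => setDist d a B) '' A)) (sSup ((fun b => setDist d b A) '' B))

/-- A rational point of `ℙ`: one spanned by a vector of `ℚⁿ`. -/
def RatPoint {n : ℕ} (p : Proj n) : Prop :=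
  ∃ v : Fin n → ℚ, p.submodule = Submodule.span ℝ {fun i => ((v i : ℝ))}

/-- A subspace of `ℝⁿ` spanned by vectors of `ℚⁿ`. -/
def IsRatSubmodule {n : ℕ} (W : Submodule ℝ (Fin n → ℝ)) : Prop :=
  ∃ T : Set (Fin n → ℚ),
    W = Submodule.span ℝ ((fun (v : Fin n → ℚ) (i : Fin n) => ((v i : ℝ))) '' T)

/-- A Schottky system `(S, 𝒜, ℛ)` with respect to the metric `d`: `S` is a nonempty
set of rank-1 unipotents, `𝒜 ⊆ ℛ` are closed, and for each `u ∈ S` there are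
`δ_u ≥ ε_u > 0` satisfying the ping-pong conditions. -/
structure IsSchottky {n : ℕ} (d : Proj n → Proj n → ℝ) (S : Set (SLZ n))
    (A R : Set (Proj n)) : Prop where
  nonempty : S.Nonempty
  unip : ∀ u ∈ S, IsR1U u
  AsubR : A ⊆ R
  closedA : IsClosed A
  closedR : IsClosed R
  cond : ∃ ε δ : SLZ n → ℝ, (∀ u ∈ S, 0 < ε u ∧ ε u ≤ δ u) ∧
    (∀ u ∈ S, ∀ k : ℤ, k ≠ 0 → ∀ x, x ∉ oThick d (fixSet u) (δ u) →
      act (u ^ k) x ∈ oThick d (attSet u) (ε u)) ∧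
    (∀ u ∈ S, ∀ v ∈ S, u ≠ v → oThick d (attSet u) (ε u) ∩ oThick d (fixSet v) (δ v) = ∅) ∧
    (∀ u ∈ S, oThick d (attSet u) (ε u) ⊆ A) ∧
    (∀ u ∈ S, oThick d (fixSet u) (δ u) ⊆ R)

/-- `H` is profinitely dense in `G`: `HN = G` for every finite-index normal `N ⊴ G`. -/
def ProfinitelyDense {G : Type*} [Group G] (H : Subgroup G) : Prop :=
  ∀ N : Subgroup G, N.Normal → N.FiniteIndex → H ⊔ N = ⊤

/-- `M` is a maximal (proper) subgroup of `G`. -/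
def IsMaxSubgroup {G : Type*} [Group G] (M : Subgroup G) : Prop :=
  M ≠ ⊤ ∧ ∀ K : Subgroup G, M < K → K = ⊤

noncomputable instance (n : ℕ) : TopologicalSpace (SLR n) :=
  inferInstanceAs (TopologicalSpace {A : Matrix (Fin n) (Fin n) ℝ // A.det = 1})

noncomputable instance (n : ℕ) : MeasurableSpace (SLR n) := borel _

/-- `Γ ≤ SL(n,ℝ)` is a lattice: a discrete subgroup admitting a Borel fundamental
domain of finite Haar measure. -/
def IsLatticeIn {n : ℕ} (Γ : Subgroup (SLR n)) : Prop :=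
  DiscreteTopology Γ ∧
  ∃ μ : MeasureTheory.Measure (SLR n), μ.IsHaarMeasure ∧
    ∃ D : Set (SLR n), MeasurableSet D ∧ μ D < ⊤ ∧
      ∀ g : SLR n, ∃! γ : Γ, (γ : SLR n)⁻¹ * g ∈ D

section Recurrence

open MeasureTheory Measure Set
open scoped Pointwise

variable {G : Type*} [Group G] [TopologicalSpace G] [IsTopologicalGroup G] [LocallyCompactSpace G]
  [SecondCountableTopology G] [MeasurableSpace G] [BorelSpace G]

/-- A Haar measure is right invariant as soon as some countable subgroup has a strict fundamental
domain of finite measure. -/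
theorem isMulRightInvariant_of_fundamentalDomain (Γ : Subgroup G) [Countable Γ] (μ : Measure G)
    [μ.IsHaarMeasure] {D : Set G} (hD : MeasurableSet D) (hfin : μ D < ⊤)
    (hdom : ∀ x : G, ∃! γ : Γ, γ • x ∈ D) : μ.IsMulRightInvariant := by
  have hfund : IsFundamentalDomain Γ D μ := .mk' hD.nullMeasurableSet hdom
  refine ⟨fun h ↦ ?_⟩
  have hfund' : IsFundamentalDomain Γ ((· * h) ⁻¹' D) μ := by
    refine .mk' (measurable_mul_const h hD).nullMeasurableSet fun x ↦ ?_
    simpa [Subgroup.smul_def, mul_assoc] using hdom (x * h)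
  have hscale := isMulLeftInvariant_eq_smul (μ.map (· * h)) μ
  have hval : μ.map (· * h) D = μ D := by
    rw [Measure.map_apply (measurable_mul_const h) hD]
    exact hfund'.measure_eq hfund
  have hpos : μ D ≠ 0 := hfund.measure_ne_zero (NeZero.ne μ)
  rw [hscale] at hval ⊢
  have hone : haarScalarFactor (μ.map (· * h)) μ = 1 := by
    rw [Measure.smul_apply, ENNReal.smul_def, smul_eq_mul] at hval
    have := (ENNReal.mul_eq_right hpos hfin.ne).1 hval
    exact_mod_cast this
  rw [hone, one_smul]

/-- Selberg's recurrence property: if `Γ` has finite covolume, every `g` has a positive power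
in `U⁻¹ Γ U`, for any nonempty open set `U`. -/
theorem exists_mul_pow_mul_inv_mem (Γ : Subgroup G) [Countable Γ] (μ : Measure G)
    [μ.IsHaarMeasure] {D : Set G} (hD : MeasurableSet D) (hfin : μ D < ⊤)
    (hdom : ∀ x : G, ∃! γ : Γ, γ • x ∈ D) (g : G) {U : Set G} (hU : IsOpen U)
    (hne : U.Nonempty) :
    ∃ k : ℕ, 0 < k ∧ ∃ u ∈ U, ∃ v ∈ U, u * g ^ k * v⁻¹ ∈ Γ := by
  have hfund : IsFundamentalDomain Γ D μ := .mk' hD.nullMeasurableSet hdom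
  have := isMulRightInvariant_of_fundamentalDomain Γ μ hD hfin hdom
  let A : ℕ → Set G := fun i ↦ {x | ∃ γ ∈ Γ, γ * x * (g ^ i)⁻¹ ∈ U}
  have hAopen (i : ℕ) : IsOpen (A i) := by
    have : A i = ⋃ γ ∈ Γ, (fun x ↦ γ * x * (g ^ i)⁻¹) ⁻¹' U := by ext; simp [A]
    rw [this]
    exact isOpen_biUnion fun γ _ ↦ hU.preimage (by fun_prop)
  have hAinv (i : ℕ) (γ : Γ) : (fun x ↦ γ • x) ⁻¹' A i = A i := by
    ext x
    constructor
    · rintro ⟨η, hη, h⟩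
      exact ⟨η * γ, mul_mem hη γ.2, by simpa [Subgroup.smul_def, mul_assoc] using h⟩
    · rintro ⟨η, hη, h⟩
      exact ⟨η * (γ : G)⁻¹, mul_mem hη (inv_mem γ.2),
        by simpa [Subgroup.smul_def, mul_assoc] using h⟩
  have hmeas (i : ℕ) : μ (A i ∩ D) = μ (A 0 ∩ D) := by
    have hfund' : IsFundamentalDomain Γ ((· * g ^ i) ⁻¹' D) μ := by
      refine .mk' (measurable_mul_const _ hD).nullMeasurableSet fun x ↦ ?_
      simpa [Subgroup.smul_def, mul_assoc] using hdom (x * g ^ i)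
    rw [hfund.measure_set_eq hfund' (hAopen 0).measurableSet (hAinv 0),
      ← measure_preimage_mul_right μ (g ^ i) (A i ∩ D)]
    congr 1
    ext x
    simp [A, mul_assoc]
  have hpos : μ (A 0 ∩ D) ≠ 0 := by
    intro h
    have hsmul (γ : Γ) : γ • A 0 = A 0 := by
      rw [← preimage_smul_inv]; exact hAinv 0 γ⁻¹
    refine (hAopen 0).measure_ne_zero μ ?_ (hfund.measure_zero_of_invariant _ hsmul h)
    obtain ⟨u, hu⟩ := hne
    exact ⟨u, 1, one_mem _, by simpa using hu⟩
  have key : ∃ i j, i ≠ j ∧ (A i ∩ A j).Nonempty := by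
    refine exists_nonempty_inter_of_measure_univ_lt_tsum_measure (μ.restrict D)
      (fun i ↦ (hAopen i).measurableSet.nullMeasurableSet) ?_
    have : ∀ i, μ.restrict D (A i) = μ (A 0 ∩ D) := fun i ↦ by
      rw [Measure.restrict_apply (hAopen i).measurableSet, hmeas i]
    simp only [this, ENNReal.tsum_const_eq_top_of_ne_zero hpos]
    simpa using hfin
  have key' : ∃ i j, i < j ∧ (A i ∩ A j).Nonempty := by
    obtain ⟨i, j, hij, h⟩ := key
    rcases hij.lt_or_gt with hlt | hlt
    · exact ⟨i, j, hlt, h⟩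
    · exact ⟨j, i, hlt, inter_comm _ _ ▸ h⟩
  obtain ⟨i, j, hij, x, ⟨γ, hγ, hx⟩, ⟨η, hη, hy⟩⟩ := key'
  refine ⟨j - i, by omega, _, hy, _, hx, ?_⟩
  have : η * x * (g ^ j)⁻¹ * g ^ (j - i) * (γ * x * (g ^ i)⁻¹)⁻¹ = η * γ⁻¹ := by
    obtain ⟨m, rfl⟩ := Nat.exists_eq_add_of_lt hij
    rw [show i + m + 1 - i = m + 1 by omega, show i + m + 1 = (m + 1) + i by omega,
      pow_add g (m + 1) i]
    group
  rw [this]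
  exact mul_mem hη (inv_mem hγ)

end Recurrence

section Metric

open Filter Topology Set

variable {n : ℕ}

theorem IsCompatMetric.nonneg {d : Proj n → Proj n → ℝ} (hd : IsCompatMetric d) (x y : Proj n) :
    0 ≤ d x y := by
  have h := hd.triangle x y x
  rw [hd.self, hd.symm y x] at h
  linarith

/-- Lines through nearby vectors are close. -/
theorem IsCompatMetric.eventually_mk_lt {d : Proj n → Proj n → ℝ} (hd : IsCompatMetric d)
    {v : Fin n → ℝ} (hv : v ≠ 0) {ε : ℝ} (hε : 0 < ε) :
    ∀ᶠ w in 𝓝 v, ∀ hw : w ≠ 0,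
      d (Projectivization.mk ℝ w hw) (Projectivization.mk ℝ v hv) < ε := by
  have hopen : IsOpen {x : Proj n | d x (Projectivization.mk ℝ v hv) < ε} := by
    rw [hd.inducing]
    intro x hx
    refine ⟨ε - d x (Projectivization.mk ℝ v hv), sub_pos.2 hx, fun y hy ↦ ?_⟩
    have := hd.triangle y x (Projectivization.mk ℝ v hv)
    rw [hd.symm y x] at this
    exact (by linarith : d y (Projectivization.mk ℝ v hv) < ε)
  have hcont : Continuous (fun w : {w : Fin n → ℝ // w ≠ 0} ↦ (Projectivization.mk' ℝ w : Proj n)) :=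
    continuous_quotient_mk'
  have hev : ∀ᶠ w : {w : Fin n → ℝ // w ≠ 0} in 𝓝 ⟨v, hv⟩,
      d (Projectivization.mk' ℝ w) (Projectivization.mk ℝ v hv) < ε :=
    (hopen.preimage hcont).mem_nhds (by simpa [Projectivization.mk'_eq_mk, hd.self] using hε)
  rw [nhds_subtype_eq_comap, eventually_comap] at hev
  filter_upwards [hev] with w h hw
  exact h ⟨w, hw⟩ rfl

theorem hDist_le {d : Proj n → Proj n → ℝ} (hd : IsCompatMetric d) {A B : Set (Proj n)} {r : ℝ}
    (hr : 0 ≤ r) (hA : ∀ a ∈ A, ∃ b ∈ B, d a b ≤ r) (hB : ∀ b ∈ B, ∃ a ∈ A, d b a ≤ r) :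
    hDist d A B ≤ r := by
  have aux (x : Proj n) (C : Set (Proj n)) (h : ∃ c ∈ C, d x c ≤ r) : setDist d x C ≤ r := by
    obtain ⟨c, hc, hle⟩ := h
    refine (csInf_le ⟨0, ?_⟩ (mem_image_of_mem _ hc)).trans hle
    rintro _ ⟨y, -, rfl⟩
    exact hd.nonneg x y
  refine max_le (Real.sSup_le ?_ hr) (Real.sSup_le ?_ hr)
  · rintro _ ⟨a, ha, rfl⟩
    exact aux a B (hA a ha)
  · rintro _ ⟨b, hb, rfl⟩
    exact aux b A (hB b hb)

/-- The hyperplane orthogonal to a covector. -/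
def covectorKer (c : Fin n → ℝ) : Submodule ℝ (Fin n → ℝ) :=
  LinearMap.ker (dotProductEquiv ℝ (Fin n) c)

@[simp] theorem mem_covectorKer {c x : Fin n → ℝ} : x ∈ covectorKer c ↔ c ⬝ᵥ x = 0 := by
  simp [covectorKer]

theorem exists_eq_covectorKer (hn : n ≠ 0) {W : Submodule ℝ (Fin n → ℝ)}
    (hW : Module.finrank ℝ W = n - 1) : ∃ c : Fin n → ℝ, c ≠ 0 ∧ W = covectorKer c := by
  have hlt : W < ⊤ := by
    refine lt_top_iff_ne_top.2 fun h ↦ ?_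
    rw [h, finrank_top, Module.finrank_fin_fun] at hW
    omega
  obtain ⟨f, hf, hle⟩ := W.exists_le_ker_of_lt_top hlt
  refine ⟨(dotProductEquiv ℝ (Fin n)).symm f, by simpa using hf, ?_⟩
  rw [covectorKer, LinearEquiv.apply_symm_apply]
  refine Submodule.eq_of_le_of_finrank_eq hle ?_
  have h := Module.Dual.finrank_ker_add_one_of_ne_zero hf
  rw [Module.finrank_fin_fun] at h
  omega

theorem mk_mem_projSet {W : Submodule ℝ (Fin n → ℝ)} {v : Fin n → ℝ} (hv : v ≠ 0) :
    Projectivization.mk ℝ v hv ∈ projSet W ↔ v ∈ W := by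
  simp [projSet, Projectivization.submodule_mk, Submodule.span_singleton_le_iff_mem]

/-- To control all points of `ℙ` it suffices to look at unit vectors. -/
theorem forall_proj_of_forall_sphere {P : Proj n → Prop}
    (h : ∀ x ∈ Metric.sphere (0 : Fin n → ℝ) 1, ∀ hx : x ≠ 0, P (Projectivization.mk ℝ x hx)) :
    ∀ p, P p := by
  intro p
  induction p using Projectivization.ind with
  | h v hv =>
    have hn : ‖v‖ ≠ 0 := norm_ne_zero_iff.2 hv
    have hne : ‖v‖⁻¹ • v ≠ 0 := smul_ne_zero (inv_ne_zero hn) hv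
    have := h (‖v‖⁻¹ • v) (by simp [norm_smul, hn]) hne
    rwa [(Projectivization.mk_eq_mk_iff' ℝ _ _ hne hv).2 ⟨_, rfl⟩] at this

/-- Nearby nonzero covectors have Hausdorff-close hyperplanes. -/
theorem eventually_hDist_lt {d : Proj n → Proj n → ℝ} (hd : IsCompatMetric d)
    {c : Fin n → ℝ} (hc : c ≠ 0) {δ : ℝ} (hδ : 0 < δ) :
    ∀ᶠ b in 𝓝 c, hDist d (projSet (covectorKer b)) (projSet (covectorKer c)) < δ := by
  have hK : IsCompact (Metric.sphere (0 : Fin n → ℝ) 1) := isCompact_sphere 0 1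
  have hdot : Continuous fun z : (Fin n → ℝ) × (Fin n → ℝ) ↦ z.1 ⬝ᵥ z.2 :=
    continuous_fst.dotProduct continuous_snd
  have h₁ : ∀ᶠ b in 𝓝 c, ∀ x ∈ Metric.sphere (0 : Fin n → ℝ) 1, ∀ hx : x ≠ 0, b ⬝ᵥ x = 0 →
      ∃ q ∈ projSet (covectorKer c), d (Projectivization.mk ℝ x hx) q ≤ δ / 2 := by
    refine hK.eventually_forall_of_forall_eventually (P := fun b x ↦ ∀ hx : x ≠ 0, b ⬝ᵥ x = 0 →
      ∃ q ∈ projSet (covectorKer c), d (Projectivization.mk ℝ x hx) q ≤ δ / 2) fun y hy ↦ ?_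
    have hy0 : y ≠ 0 := by rintro rfl; simp at hy
    by_cases hcy : c ⬝ᵥ y = 0
    · have : Tendsto Prod.snd (𝓝 (c, y)) (𝓝 y) := continuous_snd.tendsto (c, y)
      filter_upwards [this.eventually (hd.eventually_mk_lt hy0 (half_pos hδ))] with z hz hx _
      exact ⟨_, (mk_mem_projSet hy0).2 (mem_covectorKer.2 hcy), (hz hx).le⟩
    · filter_upwards [(hdot.tendsto (c, y)).eventually_ne hcy] with z hz _ h0
      exact absurd h0 hz
  have h₂ : ∀ᶠ b in 𝓝 c, ∀ x ∈ Metric.sphere (0 : Fin n → ℝ) 1, ∀ hx : x ≠ 0, c ⬝ᵥ x = 0 →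
      ∃ q ∈ projSet (covectorKer b), d (Projectivization.mk ℝ x hx) q ≤ δ / 2 := by
    refine hK.eventually_forall_of_forall_eventually (P := fun b x ↦ ∀ hx : x ≠ 0, c ⬝ᵥ x = 0 →
      ∃ q ∈ projSet (covectorKer b), d (Projectivization.mk ℝ x hx) q ≤ δ / 2) fun y hy ↦ ?_
    have hy0 : y ≠ 0 := by rintro rfl; simp at hy
    by_cases hcy : c ⬝ᵥ y = 0
    · have hcc : c ⬝ᵥ c ≠ 0 := by simpa using hc
      have hfst : Tendsto (fun z : (Fin n → ℝ) × (Fin n → ℝ) ↦ z.1 ⬝ᵥ c) (𝓝 (c, y))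
          (𝓝 (c ⬝ᵥ c)) :=
        (continuous_fst.dotProduct continuous_const).tendsto (c, y)
      have hsnd : Tendsto Prod.snd (𝓝 (c, y)) (𝓝 y) := continuous_snd.tendsto (c, y)
      have hproj : Tendsto (fun z : (Fin n → ℝ) × (Fin n → ℝ) ↦
          z.2 - (z.1 ⬝ᵥ z.2 / z.1 ⬝ᵥ c) • c) (𝓝 (c, y)) (𝓝 y) := by
        have := hsnd.sub ((((hdot.tendsto (c, y)).div hfst hcc)).smul
          (tendsto_const_nhds (x := c)))
        simpa [hcy] using this
      filter_upwards [hsnd.eventually (hd.eventually_mk_lt hy0 (half_pos (half_pos hδ))),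
        hproj.eventually (hd.eventually_mk_lt hy0 (half_pos (half_pos hδ))),
        hproj.eventually_ne hy0, hfst.eventually_ne hcc] with z hz hz' hne hzc hx _
      refine ⟨Projectivization.mk ℝ _ hne, (mk_mem_projSet hne).2 (mem_covectorKer.2 ?_), ?_⟩
      · rw [dotProduct_sub, dotProduct_smul, smul_eq_mul, div_mul_cancel₀ _ hzc, sub_self]
      · have := hd.triangle (Projectivization.mk ℝ z.2 hx) (Projectivization.mk ℝ y hy0)
          (Projectivization.mk ℝ _ hne)
        have h₃ := hz hx
        have h₄ := hz' hne
        rw [hd.symm] at h₄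
        linarith
    · have : Tendsto (fun z : (Fin n → ℝ) × (Fin n → ℝ) ↦ c ⬝ᵥ z.2) (𝓝 (c, y)) (𝓝 (c ⬝ᵥ y)) :=
        (continuous_const.dotProduct continuous_snd).tendsto (c, y)
      filter_upwards [this.eventually_ne hcy] with z hz _ h0
      exact absurd h0 hz
  filter_upwards [h₁, h₂] with b hb hb'
  refine (hDist_le hd (half_pos hδ).le ?_ ?_).trans_lt (half_lt_self hδ)
  · refine forall_proj_of_forall_sphere fun x hx hx0 hmem ↦ hb x hx hx0 ?_
    exact mem_covectorKer.1 ((mk_mem_projSet hx0).1 hmem)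
  · refine forall_proj_of_forall_sphere fun x hx hx0 hmem ↦ hb' x hx hx0 ?_
    exact mem_covectorKer.1 ((mk_mem_projSet hx0).1 hmem)

end Metric

section Dilation

open Filter Topology

variable {m : Type*} [DecidableEq m]

/-- The map scaling the line of `v` by `t` and the line of `q` by `t⁻¹`, and fixing the common
kernel of the covectors `ψ` and `c` (when `v, q` and `ψ, c` are dual to each other). -/
noncomputable def dilation (v ψ q c : m → ℝ) (t : ℝ) : Matrix m m ℝ :=
  1 + (t - 1) • vecMulVec v ψ + (t⁻¹ - 1) • vecMulVec q c

variable {v ψ q c : m → ℝ}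

theorem dilation_one : dilation v ψ q c 1 = 1 := by
  simp [dilation]

theorem tendsto_inv_smul_dilation :
    Tendsto (fun t : ℝ ↦ t⁻¹ • dilation v ψ q c t) atTop (𝓝 (vecMulVec v ψ)) := by
  have hinv : Tendsto (fun t : ℝ ↦ t⁻¹) atTop (𝓝 0) := tendsto_inv_atTop_zero
  have h := ((hinv.smul_const (1 : Matrix m m ℝ)).add
    (((tendsto_const_nhds (x := (1 : ℝ))).sub hinv).smul_const (vecMulVec v ψ))).add
    ((((hinv.mul hinv).sub hinv)).smul_const (vecMulVec q c))
  simp only [zero_smul, zero_add, sub_zero, one_smul, mul_zero, add_zero] at h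
  refine h.congr' ?_
  filter_upwards [eventually_ne_atTop 0] with t ht
  simp only [dilation, smul_add, smul_smul, mul_sub, inv_mul_cancel₀ ht, mul_one]

theorem tendsto_inv_smul_dilation_inv :
    Tendsto (fun t : ℝ ↦ t⁻¹ • dilation v ψ q c t⁻¹) atTop (𝓝 (vecMulVec q c)) := by
  have (t : ℝ) : dilation v ψ q c t⁻¹ = dilation q c v ψ t := by
    simp only [dilation, inv_inv]
    abel
  simpa only [this] using tendsto_inv_smul_dilation (v := q) (ψ := c) (q := v) (c := ψ)

variable [Fintype m]

theorem dilation_mul (h₁ : ψ ⬝ᵥ v = 1) (h₂ : c ⬝ᵥ q = 1) (h₃ : ψ ⬝ᵥ q = 0) (h₄ : c ⬝ᵥ v = 0)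
    (s t : ℝ) :
    dilation v ψ q c s * dilation v ψ q c t = dilation v ψ q c (s * t) := by
  simp only [dilation, add_mul, mul_add, one_mul, mul_one, smul_mul_assoc, mul_smul_comm,
    vecMulVec_mul_vecMulVec, h₁, h₂, h₃, h₄, one_smul, zero_smul, vecMulVec_zero, mul_inv,
    smul_zero]
  module

theorem det_dilation (h₁ : ψ ⬝ᵥ v = 1) (h₂ : c ⬝ᵥ q = 1) (h₃ : ψ ⬝ᵥ q = 0) {t : ℝ}
    (ht : t ≠ 0) : (dilation v ψ q c t).det = 1 := by
  have hfac : dilation v ψ q c t =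
      (1 + vecMulVec ((t - 1) • v) ψ) * (1 + vecMulVec ((t⁻¹ - 1) • q) c) := by
    simp only [dilation, add_mul, mul_add, one_mul, mul_one, smul_vecMulVec, smul_mul_assoc,
      mul_smul_comm, vecMulVec_mul_vecMulVec, h₃, zero_smul, vecMulVec_zero, smul_zero]
    module
  have hdet (a b : m → ℝ) : (1 + vecMulVec a b).det = 1 + b ⬝ᵥ a := by
    rw [vecMulVec_eq Unit, det_one_add_replicateCol_mul_replicateRow]
  rw [hfac, det_mul, hdet, hdet, dotProduct_smul, dotProduct_smul, h₁, h₂]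
  simp only [smul_eq_mul, mul_one, add_sub_cancel]
  exact mul_inv_cancel₀ ht

end Dilation

section GeneralPosition

variable {m : Type*} [Fintype m]

theorem exists_dotProduct_ne_zero_and {a b : m → ℝ} {S : Submodule ℝ (m → ℝ)}
    (ha : ∃ x ∈ S, x ⬝ᵥ a ≠ 0) (hb : ∃ x ∈ S, x ⬝ᵥ b ≠ 0) :
    ∃ x ∈ S, x ⬝ᵥ a ≠ 0 ∧ x ⬝ᵥ b ≠ 0 := by
  obtain ⟨x, hx, hxa⟩ := ha
  obtain ⟨y, hy, hyb⟩ := hb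
  by_cases hxb : x ⬝ᵥ b = 0
  · by_cases hya : y ⬝ᵥ a = 0
    · exact ⟨x + y, S.add_mem hx hy, by simpa [add_dotProduct, hya], by simpa [add_dotProduct, hxb]⟩
    · exact ⟨y, hy, hya, hyb⟩
  · exact ⟨x, hx, hxa, hxb⟩

variable [DecidableEq m] in
/-- Given two incident point-hyperplane pairs, there is a third one in general position
with both. -/
theorem exists_transverse_flag {v₁ v₂ c₁ c₂ : m → ℝ} (hv₁ : v₁ ≠ 0) (hv₂ : v₂ ≠ 0) (hc₁ : c₁ ≠ 0)
    (hc₂ : c₂ ≠ 0) (h₁ : c₁ ⬝ᵥ v₁ = 0) (h₂ : c₂ ⬝ᵥ v₂ = 0) :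
    ∃ q ψ : m → ℝ, ψ ⬝ᵥ q = 0 ∧ c₁ ⬝ᵥ q ≠ 0 ∧ c₂ ⬝ᵥ q ≠ 0 ∧ ψ ⬝ᵥ v₁ ≠ 0 ∧ ψ ⬝ᵥ v₂ ≠ 0 := by
  have hself {a : m → ℝ} (ha : a ≠ 0) : a ⬝ᵥ a ≠ 0 := by simpa using ha
  obtain ⟨q, -, hq₁, hq₂⟩ := exists_dotProduct_ne_zero_and (S := ⊤)
    ⟨c₁, trivial, hself hc₁⟩ ⟨c₂, trivial, hself hc₂⟩
  rw [dotProduct_comm] at hq₁ hq₂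
  let S : Submodule ℝ (m → ℝ) := LinearMap.ker (dotProductEquiv ℝ m q)
  have hS {x : m → ℝ} : x ∈ S ↔ x ⬝ᵥ q = 0 := by simp [S, dotProduct_comm q x]
  have aux {v c : m → ℝ} (hv : v ≠ 0) (hcv : c ⬝ᵥ v = 0) (hcq : c ⬝ᵥ q ≠ 0) :
      ∃ x ∈ S, x ⬝ᵥ v ≠ 0 := by
    refine ⟨v - (v ⬝ᵥ q / c ⬝ᵥ q) • c, hS.2 ?_, ?_⟩
    · rw [sub_dotProduct, smul_dotProduct, smul_eq_mul, div_mul_cancel₀ _ hcq, sub_self]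
    · rw [sub_dotProduct, smul_dotProduct, hcv, smul_zero, sub_zero]
      exact hself hv
  obtain ⟨ψ, hψ, hψ₁, hψ₂⟩ := exists_dotProduct_ne_zero_and (aux hv₁ h₁ hq₁) (aux hv₂ h₂ hq₂)
  exact ⟨q, ψ, hS.1 hψ, hq₁, hq₂, hψ₁, hψ₂⟩

end GeneralPosition

section Lattice

open Filter Topology MeasureTheory

variable {n : ℕ}

instance : IsTopologicalGroup (SLR n) :=
  Matrix.SpecialLinearGroup.topologicalGroup

instance : SecondCountableTopology (SLR n) := by
  have : SecondCountableTopology (Matrix (Fin n) (Fin n) ℝ) :=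
    inferInstanceAs (SecondCountableTopology (Fin n → Fin n → ℝ))
  exact TopologicalSpace.Subtype.secondCountableTopology
    {A : Matrix (Fin n) (Fin n) ℝ | A.det = 1}

instance : LocallyCompactSpace (SLR n) := by
  have hclosed : IsClosed {A : Matrix (Fin n) (Fin n) ℝ | A.det = 1} :=
    isClosed_eq continuous_id.matrix_det continuous_const
  have : LocallyCompactSpace (Matrix (Fin n) (Fin n) ℝ) :=
    inferInstanceAs (LocallyCompactSpace (Fin n → Fin n → ℝ))
  exact hclosed.isClosedEmbedding_subtypeVal.locallyCompactSpace

instance : BorelSpace (SLR n) := ⟨rfl⟩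

theorem IsLatticeIn.exists_mul_pow_mul_inv_mem {Γ : Subgroup (SLR n)} (hΓ : IsLatticeIn Γ)
    (g : SLR n) {U : Set (SLR n)} (hU : IsOpen U) (hne : U.Nonempty) :
    ∃ k : ℕ, 0 < k ∧ ∃ u ∈ U, ∃ v ∈ U, u * g ^ k * v⁻¹ ∈ Γ := by
  obtain ⟨hdisc, μ, hμ, D, hD, hfin, hdom⟩ := hΓ
  have : Countable Γ := countable_of_Lindelof_of_discrete
  refine _root_.exists_mul_pow_mul_inv_mem Γ μ hD hfin (fun x ↦ ?_) g hU hne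
  obtain ⟨γ, hγ, huniq⟩ := hdom x
  refine ⟨γ⁻¹, by simpa [Subgroup.smul_def] using hγ, fun η hη ↦ ?_⟩
  rw [← huniq η⁻¹ (by simpa [Subgroup.smul_def] using hη), inv_inv]

/-- Elements of a lattice approximate arbitrarily strong dilations up to small perturbations. -/
theorem IsLatticeIn.exists_mem_of_eventually {Γ : Subgroup (SLR n)} (hΓ : IsLatticeIn Γ)
    {v ψ q c : Fin n → ℝ} (h₁ : ψ ⬝ᵥ v = 1) (h₂ : c ⬝ᵥ q = 1) (h₃ : ψ ⬝ᵥ q = 0)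
    (h₄ : c ⬝ᵥ v = 0) {P : (SLR n × SLR n) × ℝ → Prop}
    (hP : ∀ᶠ z in (𝓝 1 ×ˢ 𝓝 1) ×ˢ atTop, P z) :
    ∃ γ ∈ Γ, ∃ u w : SLR n, ∃ t : ℝ, P ((u, w), t) ∧
      (γ : Matrix (Fin n) (Fin n) ℝ) = u * dilation v ψ q c t * (w⁻¹ : SLR n) ∧
      ((γ⁻¹ : SLR n) : Matrix (Fin n) (Fin n) ℝ) =
        w * dilation v ψ q c t⁻¹ * (u⁻¹ : SLR n) := by
  obtain ⟨p, hp, r, hr, hpr⟩ := eventually_prod_iff.1 hP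
  obtain ⟨p₁, hp₁, p₂, hp₂, hpp⟩ := eventually_prod_iff.1 hp
  obtain ⟨U, hUsub, hU, hU1⟩ := mem_nhds_iff.1 (inter_mem hp₁ hp₂)
  obtain ⟨T, hT⟩ := eventually_atTop.1 hr
  let s := max T 1
  have hs1 : 1 ≤ s := le_max_right _ _
  have hs0 : s ≠ 0 := by positivity
  let g : SLR n := ⟨dilation v ψ q c s, det_dilation h₁ h₂ h₃ hs0⟩
  obtain ⟨k, hk, u, hu, w, hw, hmem⟩ := hΓ.exists_mul_pow_mul_inv_mem g hU ⟨1, hU1⟩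
  have hpow (j : ℕ) : ((g ^ j : SLR n) : Matrix (Fin n) (Fin n) ℝ) =
      dilation v ψ q c (s ^ j) := by
    induction j with
    | zero => simp [dilation_one]
    | succ j ih =>
      rw [pow_succ, Matrix.SpecialLinearGroup.coe_mul, ih, pow_succ]
      exact dilation_mul h₁ h₂ h₃ h₄ _ _
  have hsk : s ^ k ≠ 0 := pow_ne_zero k hs0
  let gi : SLR n := ⟨dilation v ψ q c (s ^ k)⁻¹, det_dilation h₁ h₂ h₃ (inv_ne_zero hsk)⟩
  have hgi : (g ^ k)⁻¹ = gi := by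
    refine inv_eq_of_mul_eq_one_right (Subtype.ext ?_)
    rw [Matrix.SpecialLinearGroup.coe_mul, hpow, Matrix.SpecialLinearGroup.coe_one]
    exact (dilation_mul h₁ h₂ h₃ h₄ _ _).trans (by rw [mul_inv_cancel₀ hsk, dilation_one])
  refine ⟨_, hmem, u, w, s ^ k, hpr (hpp (hUsub hu).1 (hUsub hw).2) (hT _ ?_), ?_, ?_⟩
  · exact (le_max_left T 1).trans (le_self_pow₀ hs1 hk.ne')
  · rw [Matrix.SpecialLinearGroup.coe_mul, Matrix.SpecialLinearGroup.coe_mul, hpow]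
  · rw [_root_.mul_inv_rev, _root_.mul_inv_rev, inv_inv, hgi, ← mul_assoc, Matrix.SpecialLinearGroup.coe_mul,
      Matrix.SpecialLinearGroup.coe_mul]

theorem actR_mk (g : SLR n) {v : Fin n → ℝ} (hv : v ≠ 0)
    (hgv : (g : Matrix (Fin n) (Fin n) ℝ) *ᵥ v ≠ 0) :
    actR g (Projectivization.mk ℝ v hv) = Projectivization.mk ℝ _ hgv := by
  rfl

theorem actSubR_covectorKer (g : SLR n) (c : Fin n → ℝ) :
    actSubR g (covectorKer c) =
      covectorKer (c ᵥ* ((g⁻¹ : SLR n) : Matrix (Fin n) (Fin n) ℝ)) := by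
  have hmul : ((g⁻¹ : SLR n) : Matrix (Fin n) (Fin n) ℝ) * g = 1 := by
    rw [← Matrix.SpecialLinearGroup.coe_mul, inv_mul_cancel, Matrix.SpecialLinearGroup.coe_one]
  have hmul' : (g : Matrix (Fin n) (Fin n) ℝ) * (g⁻¹ : SLR n) = 1 := by
    rw [← Matrix.SpecialLinearGroup.coe_mul, mul_inv_cancel, Matrix.SpecialLinearGroup.coe_one]
  ext x
  simp only [actSubR, Submodule.mem_map, mem_covectorKer, mulVecLin_apply, ← dotProduct_mulVec]
  constructor
  · rintro ⟨y, hy, rfl⟩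
    rwa [mulVec_mulVec, hmul, one_mulVec]
  · intro hx
    exact ⟨_, hx, by rw [mulVec_mulVec, hmul', one_mulVec]⟩

theorem covectorKer_smul {a : ℝ} (ha : a ≠ 0) (c : Fin n → ℝ) :
    covectorKer (a • c) = covectorKer c := by
  ext x
  simp [ha]

end Lattice

/-- Corollary 2.10: for a lattice `Γ ≤ SL(n,ℝ)` and flags `p₁ ∈ L₁`, `p₂ ∈ L₂`,
there is `γ ∈ Γ` moving `p₁` `ε`-close to `p₂` and `L₁` (in Hausdorff distance)
`δ`-close to `L₂`. -/
theorem conze_guivarch_corollary (n : ℕ) (hn : 3 ≤ n) (Γ : Subgroup (SLR n))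
    (hΓ : IsLatticeIn Γ) (d : Proj n → Proj n → ℝ) (hd : IsCompatMetric d)
    (p₁ p₂ : Proj n) (W₁ W₂ : Submodule ℝ (Fin n → ℝ))
    (hW₁ : Module.finrank ℝ W₁ = n - 1) (hW₂ : Module.finrank ℝ W₂ = n - 1)
    (hp₁ : p₁.submodule ≤ W₁) (hp₂ : p₂.submodule ≤ W₂)
    (ε δ : ℝ) (hε : 0 < ε) (hδ : 0 < δ) :
    ∃ γ ∈ Γ, d (actR γ p₁) p₂ < ε ∧
      hDist d (projSet (actSubR γ W₁)) (projSet W₂) < δ := by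
  open Filter Topology in
  have hn0 : n ≠ 0 := by omega
  obtain ⟨c₁, hc₁, rfl⟩ := exists_eq_covectorKer hn0 hW₁
  obtain ⟨c₂, hc₂, rfl⟩ := exists_eq_covectorKer hn0 hW₂
  induction p₁ using Projectivization.ind with | h v₁ hv₁ => ?_
  induction p₂ using Projectivization.ind with | h v₂ hv₂ => ?_
  have hcv₁ : c₁ ⬝ᵥ v₁ = 0 := mem_covectorKer.1 ((mk_mem_projSet hv₁).1 hp₁)
  have hcv₂ : c₂ ⬝ᵥ v₂ = 0 := mem_covectorKer.1 ((mk_mem_projSet hv₂).1 hp₂)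
  obtain ⟨q, ψ, hψq, hq₁, hq₂, hψ₁, hψ₂⟩ := exists_transverse_flag hv₁ hv₂ hc₁ hc₂ hcv₁ hcv₂
  let φ := (ψ ⬝ᵥ v₂)⁻¹ • ψ
  let c := (c₂ ⬝ᵥ q)⁻¹ • c₂
  have h₁ : φ ⬝ᵥ v₂ = 1 := by simp [φ, hψ₂]
  have h₂ : c ⬝ᵥ q = 1 := by simp [c, hq₂]
  have h₃ : φ ⬝ᵥ q = 0 := by simp [φ, hψq]
  have h₄ : c ⬝ᵥ v₂ = 0 := by simp [c, hcv₂]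
  have hφ₁ : φ ⬝ᵥ v₁ ≠ 0 := by simp [φ, hψ₁, hψ₂]
  have hker : covectorKer ((c₁ ⬝ᵥ q) • c) = covectorKer c₂ := by
    rw [covectorKer_smul hq₁, covectorKer_smul (inv_ne_zero hq₂)]
  have hcne : (c₁ ⬝ᵥ q) • c ≠ 0 := smul_ne_zero hq₁ (smul_ne_zero (inv_ne_zero hq₂) hc₂)
  have hvne : (φ ⬝ᵥ v₁) • v₂ ≠ 0 := smul_ne_zero hφ₁ hv₂
  let F : Filter ((SLR n × SLR n) × ℝ) := (𝓝 1 ×ˢ 𝓝 1) ×ˢ atTop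
  have hcoe : Continuous fun g : SLR n ↦ (g : Matrix (Fin n) (Fin n) ℝ) := continuous_subtype_val
  have hcoe' : Continuous fun g : SLR n ↦ ((g⁻¹ : SLR n) : Matrix (Fin n) (Fin n) ℝ) :=
    hcoe.comp continuous_inv
  have hu : Tendsto (fun z : (SLR n × SLR n) × ℝ ↦ z.1.1) F (𝓝 1) :=
    tendsto_fst.comp tendsto_fst
  have hw : Tendsto (fun z : (SLR n × SLR n) × ℝ ↦ z.1.2) F (𝓝 1) :=
    tendsto_snd.comp tendsto_fst
  have ht : Tendsto (fun z : (SLR n × SLR n) × ℝ ↦ z.2) F atTop := tendsto_snd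
  have hvec : Tendsto (fun z : (SLR n × SLR n) × ℝ ↦
      ((z.1.1 : Matrix (Fin n) (Fin n) ℝ) * (z.2⁻¹ • dilation v₂ φ q c z.2) *
        ((z.1.2⁻¹ : SLR n) : Matrix (Fin n) (Fin n) ℝ)) *ᵥ v₁) F (𝓝 ((φ ⬝ᵥ v₁) • v₂)) := by
    have h := (((hcoe.tendsto 1).comp hu).mul ((tendsto_inv_smul_dilation (v := v₂) (ψ := φ)
      (q := q) (c := c)).comp ht)).mul ((hcoe'.tendsto 1).comp hw)
    have h' := ((continuous_id.matrix_mulVec (continuous_const (y := v₁))).tendsto _).comp h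
    convert h' using 2 <;> simp [vecMulVec_mulVec]
  have hcovec : Tendsto (fun z : (SLR n × SLR n) × ℝ ↦
      c₁ ᵥ* ((z.1.2 : Matrix (Fin n) (Fin n) ℝ) * (z.2⁻¹ • dilation v₂ φ q c z.2⁻¹) *
        ((z.1.1⁻¹ : SLR n) : Matrix (Fin n) (Fin n) ℝ))) F (𝓝 ((c₁ ⬝ᵥ q) • c)) := by
    have h := (((hcoe.tendsto 1).comp hw).mul ((tendsto_inv_smul_dilation_inv (v := v₂) (ψ := φ)
      (q := q) (c := c)).comp ht)).mul ((hcoe'.tendsto 1).comp hu)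
    have h' := (((continuous_const (y := c₁)).matrix_vecMul continuous_id).tendsto _).comp h
    convert h' using 2 <;> simp [vecMul_vecMulVec]
  obtain ⟨γ, hγ, u, w, t, ⟨ht0, hpt, hhyp⟩, hγu, hγi⟩ :=
    hΓ.exists_mem_of_eventually h₁ h₂ h₃ h₄
      ((ht.eventually_ne_atTop 0).and
        ((hvec.eventually (hd.eventually_mk_lt hvne hε)).and
          (hcovec.eventually (eventually_hDist_lt hd hcne hδ))))
  refine ⟨γ, hγ, ?_, ?_⟩
  · have hγv : (γ : Matrix (Fin n) (Fin n) ℝ) *ᵥ v₁ ≠ 0 := fun h ↦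
      hv₁ (γ.toLin'.injective (h.trans (map_zero γ.toLin').symm))
    have hscale : ((u : Matrix (Fin n) (Fin n) ℝ) * (t⁻¹ • dilation v₂ φ q c t) *
        ((w⁻¹ : SLR n) : Matrix (Fin n) (Fin n) ℝ)) *ᵥ v₁ = t⁻¹ • (γ : Matrix (Fin n) (Fin n) ℝ) *ᵥ v₁ := by
      rw [hγu, mul_smul_comm, smul_mul_assoc, smul_mulVec]
    have hne : ((u : Matrix (Fin n) (Fin n) ℝ) * (t⁻¹ • dilation v₂ φ q c t) *
        ((w⁻¹ : SLR n) : Matrix (Fin n) (Fin n) ℝ)) *ᵥ v₁ ≠ 0 := by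
      rw [hscale]
      exact smul_ne_zero (inv_ne_zero ht0) hγv
    rw [actR_mk γ hv₁ hγv]
    convert hpt hne using 2
    · exact ((Projectivization.mk_eq_mk_iff' ℝ _ _ hne hγv).2 ⟨t⁻¹, hscale.symm⟩).symm
    · exact ((Projectivization.mk_eq_mk_iff' ℝ _ _ hvne hv₂).2 ⟨_, rfl⟩).symm
  · rw [actSubR_covectorKer, hγi, ← hker, ← covectorKer_smul (inv_ne_zero ht0)]
    convert hhyp using 4
    simp only [mul_smul_comm, smul_mul_assoc, vecMul_smul]
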